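/- arXiv:1810.08124 — 3 statements merged into one kernel-verified Lean document; each statement's English description precedes it below -/
import Mathlib

section
/- Let A = Z × L be the attribute space, where Z is a finite set of zones and L is a finite linearly ordered set of battery levels, with the partial order (z,l) ⪯ (z',l') iff z = z' and l ≤ l'. Let D be a finite decision set, Ω a finite sample space with weights p : Ω → ℝ≥0 satisfying ∑_{ω∈Ω} p(ω) = 1, a transition function f : A → D → Ω → A, rewards c : {0,…,T−1} → A → D → ℝ, a terminal reward c_T : A → ℝ, and feasible-decision sets X : {0,…,T−1} → A → Finset D with X(t,a) nonempty for every t and a. Assume: (i) for all a ⪯ a', d ∈ D and ω ∈ Ω, f(a,d,ω) ⪯ f(a',d,ω); (ii) for all t, a ⪯ a' and d ∈ D, c(t,a,d) ≤ c(t,a',d), and c_T(a) ≤ c_T(a'); (iii) for all t, a ⪯ a' implies X(t,a) ⊆ X(t,a'). Define the value functions by backward recursion: V_T(a) = c_T(a) and, for t < T, V_t(a) = max_{d ∈ X(t,a)} ( c(t,a,d) + ∑_{ω∈Ω} p(ω) · V_{t+1}(f(a,d,ω)) ). Then for every t ≤ T and every a ⪯ a', V_t(a) ≤ V_t(a'); i.e.,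 the pre-decision value functions are monotonically increasing in the battery dimension. -/
/-- **Proposition 1 (pre-decision part).**
Attribute space `A = Z × L` (zone, battery level) with the partial order
`(z,l) ⪯ (z',l') ↔ z = z' ∧ l ≤ l'`.  Under order-preserving transitions,
monotone rewards and nested feasible decision sets, the value functions
defined by the backward Bellman recursion are monotonically increasing in
the battery dimension. -/
theorem pre_decision_value_monotone_in_battery
    {Z L D Ω : Type*} [Fintype Z] [Fintype L] [LinearOrder L]
    [Fintype D] [Fintype Ω]
    (p : Ω → ℝ) (hp : ∀ ω, 0 ≤ p ω) (hpsum : ∑ ω, p ω = 1)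
    (T : ℕ)
    (f : Z × L → D → Ω → Z × L)
    (c : ℕ → Z × L → D → ℝ) (cT : Z × L → ℝ)
    (X : ℕ → Z × L → Finset D)
    (hXne : ∀ t a, (X t a).Nonempty)
    -- (i) the transition function is order preserving
    (hf : ∀ a a' : Z × L, a.1 = a'.1 → a.2 ≤ a'.2 → ∀ d ω,
      (f a d ω).1 = (f a' d ω).1 ∧ (f a d ω).2 ≤ (f a' d ω).2)
    -- (ii) rewards and terminal reward are monotone
    (hc : ∀ t, t < T → ∀ a a' : Z × L, a.1 = a'.1 → a.2 ≤ a'.2 → ∀ d,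
      c t a d ≤ c t a' d)
    (hcT : ∀ a a' : Z × L, a.1 = a'.1 → a.2 ≤ a'.2 → cT a ≤ cT a')
    -- (iii) feasible decision sets are nested
    (hX : ∀ t, t < T → ∀ a a' : Z × L, a.1 = a'.1 → a.2 ≤ a'.2 →
      X t a ⊆ X t a')
    -- the value functions, defined by backward recursion
    (V : ℕ → Z × L → ℝ)
    (hVT : ∀ a, V T a = cT a)
    (hVt : ∀ t, (ht : t < T) → ∀ a, V t a =
      (X t a).sup' (hXne t a)
        (fun d => c t a d + ∑ ω, p ω * V (t + 1) (f a d ω))) :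
    ∀ t ≤ T, ∀ a a' : Z × L, a.1 = a'.1 → a.2 ≤ a'.2 → V t a ≤ V t a' := by
  intro t ht
  induction ht using Nat.decreasingInduction with
  | self =>
    intro a a' hz hl
    rw [hVT, hVT]
    exact hcT a a' hz hl
  | of_succ t ht ih =>
    intro a a' hz hl
    rw [hVt t ht a, hVt t ht a']
    refine Finset.sup'_le _ _ fun d hd => ?_
    refine le_trans (add_le_add (hc t ht a a' hz hl d) (Finset.sum_le_sum fun ω _ => ?_))
      (Finset.le_sup' (fun d => c t a' d + ∑ ω, p ω * V (t + 1) (f a' d ω))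
        (hX t ht a a' hz hl hd))
    obtain ⟨hz', hl'⟩ := hf a a' hz hl d ω
    exact mul_le_mul_of_nonneg_left (ih _ _ hz' hl') (hp ω)
end

section
/- Under the same assumptions as Proposition 1 — A = Z × L with the partial order (z,l) ⪯ (z',l') iff z = z' and l ≤ l'; D finite; Ω finite with weights p summing to 1; transition f : A → D → Ω → A satisfying f(a,d,ω) ⪯ f(a',d,ω) whenever a ⪯ a'; rewards c(t,·,d) and terminal reward c_T monotone with respect to ⪯; feasible sets X(t,·) nonempty and nested (a ⪯ a' implies X(t,a) ⊆ X(t,a')); and value functions V_t defined by the backward recursion V_T = c_T, V_t(a) = max_{d ∈ X(t,a)} ( c(t,a,d) + ∑_{ω} p(ω) V_{t+1}(f(a,d,ω)) ) — define for t < T and d ∈ D the post-decision value function V^x_t(a,d) = ∑_{ω∈Ω} p(ω) · V_{t+1}(f(a,d,ω)). Then for every t < T, every d ∈ D, and every a ⪯ a', V^x_t(a,d) ≤ V^x_t(a',d); i.e., the post-decision value functions are monotonically increasing in the battery dimension. -/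
/-- **Proposition 1 (post-decision part).**
Under the same assumptions as Proposition 1, the post-decision value
functions `V^x_t(a,d) = ∑ ω, p ω * V_{t+1}(f a d ω)` are monotonically
increasing in the battery dimension. -/
theorem post_decision_value_monotone_in_battery
    {Z L D Ω : Type*} [Fintype Z] [Fintype L] [LinearOrder L]
    [Fintype D] [Fintype Ω]
    (p : Ω → ℝ) (hp : ∀ ω, 0 ≤ p ω) (hpsum : ∑ ω, p ω = 1)
    (T : ℕ)
    (f : Z × L → D → Ω → Z × L)
    (c : ℕ → Z × L → D → ℝ) (cT : Z × L → ℝ)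
    (X : ℕ → Z × L → Finset D)
    (hXne : ∀ t a, (X t a).Nonempty)
    -- (i) the transition function is order preserving
    (hf : ∀ a a' : Z × L, a.1 = a'.1 → a.2 ≤ a'.2 → ∀ d ω,
      (f a d ω).1 = (f a' d ω).1 ∧ (f a d ω).2 ≤ (f a' d ω).2)
    -- (ii) rewards and terminal reward are monotone
    (hc : ∀ t, t < T → ∀ a a' : Z × L, a.1 = a'.1 → a.2 ≤ a'.2 → ∀ d,
      c t a d ≤ c t a' d)
    (hcT : ∀ a a' : Z × L, a.1 = a'.1 → a.2 ≤ a'.2 → cT a ≤ cT a')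
    -- (iii) feasible decision sets are nested
    (hX : ∀ t, t < T → ∀ a a' : Z × L, a.1 = a'.1 → a.2 ≤ a'.2 →
      X t a ⊆ X t a')
    -- the value functions, defined by backward recursion
    (V : ℕ → Z × L → ℝ)
    (hVT : ∀ a, V T a = cT a)
    (hVt : ∀ t, (ht : t < T) → ∀ a, V t a =
      (X t a).sup' (hXne t a)
        (fun d => c t a d + ∑ ω, p ω * V (t + 1) (f a d ω))) :
    ∀ t < T, ∀ d : D, ∀ a a' : Z × L, a.1 = a'.1 → a.2 ≤ a'.2 →
      ∑ ω, p ω * V (t + 1) (f a d ω) ≤ ∑ ω, p ω * V (t + 1) (f a' d ω) := by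
  have hV : ∀ t ≤ T, ∀ a a' : Z × L, a.1 = a'.1 → a.2 ≤ a'.2 → V t a ≤ V t a' := by
    intro t ht
    induction ht using Nat.decreasingInduction with
    | self =>
      intro a a' hz hl
      simpa only [hVT] using hcT a a' hz hl
    | of_succ t ht ih =>
      intro a a' hz hl
      rw [hVt t ht a, hVt t ht a']
      refine Finset.sup'_le _ _ fun d hd => ?_
      refine le_trans ?_ (Finset.le_sup' _ (hX t ht a a' hz hl hd))
      refine add_le_add (hc t ht a a' hz hl d) (Finset.sum_le_sum fun ω _ => ?_)
      obtain ⟨h₁, h₂⟩ := hf a a' hz hl d ω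
      exact mul_le_mul_of_nonneg_left (ih _ _ h₁ h₂) (hp ω)
  intro t ht d a a' hz hl
  refine Finset.sum_le_sum fun ω _ => ?_
  obtain ⟨h₁, h₂⟩ := hf a a' hz hl d ω
  exact mul_le_mul_of_nonneg_left (hV (t + 1) ht _ _ h₁ h₂) (hp ω)
end

section
/- Let (A, ⪯) be a partially ordered set, let v : A → ℝ be monotone with respect to ⪯ (a ⪯ b implies v(a) ≤ v(b)), let a' ∈ A and h ∈ ℝ. Define the projected function w : A → ℝ by: w(a) = h if a = a'; w(a) = max(h, v(a)) if a' ⪯ a and a ≠ a'; w(a) = min(h, v(a)) if a ⪯ a' and a ≠ a'; and w(a) = v(a) if a and a' are incomparable. Then w is monotone with respect to ⪯: for all a ⪯ b, w(a) ≤ w(b). -/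
/-- **The projection operator `Π_B` preserves monotonicity (battery dimension).**
Given a monotone value function approximation `v` on a partially ordered
attribute space, a reference attribute `a'` and a new smoothed observation
`h`, the projected function `w` (equal to `h` at `a'`, to `max h (v a)` above
`a'`, to `min h (v a)` below `a'`, and to `v a` at incomparable attributes)
is again monotone. -/
theorem projection_battery_preserves_monotone
    {A : Type*} [PartialOrder A]
    (v : A → ℝ) (hv : ∀ a b : A, a ≤ b → v a ≤ v b)
    (a' : A) (h : ℝ)
    (w : A → ℝ)
    (hw_eq : w a' = h)
    (hw_above : ∀ a : A, a' ≤ a → a ≠ a' → w a = max h (v a))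
    (hw_below : ∀ a : A, a ≤ a' → a ≠ a' → w a = min h (v a))
    (hw_incomp : ∀ a : A, ¬ a' ≤ a → ¬ a ≤ a' → w a = v a) :
    ∀ a b : A, a ≤ b → w a ≤ w b := by
  intro a b hab
  have hvab := hv a b hab
  by_cases ha : a' ≤ a
  · have hb : a' ≤ b := ha.trans hab
    rcases eq_or_ne a a' with rfl | hne
    · rcases eq_or_ne b a with rfl | hbne
      · exact le_rfl
      · rw [hw_eq, hw_above b hb hbne]
        exact le_max_left _ _
    · have hbne : b ≠ a' := by
        rintro rfl
        exact hne (le_antisymm hab ha)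
      rw [hw_above a ha hne, hw_above b hb hbne]
      exact max_le_max_left h hvab
  · have hne : a ≠ a' := fun e => ha e.ge
    have hwa : w a ≤ v a := by
      by_cases ha' : a ≤ a'
      · exact (hw_below a ha' hne).trans_le (min_le_right _ _)
      · exact (hw_incomp a ha ha').le
    by_cases hb : b ≤ a'
    · have hwa' : w a = min h (v a) := hw_below a (hab.trans hb) hne
      rcases eq_or_ne b a' with rfl | hbne
      · rw [hwa', hw_eq]
        exact min_le_left _ _
      · rw [hwa', hw_below b hb hbne]
        exact min_le_min_left h hvab
    · have hvb : v b ≤ w b := by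
        by_cases hb' : a' ≤ b
        · rw [hw_above b hb' fun e => hb e.le]
          exact le_max_right _ _
        · exact (hw_incomp b hb' hb).ge
      exact hwa.trans (hvab.trans hvb)
end
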